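/- arXiv:2309.10427 — 3 statements merged into one kernel-verified Lean document; each statement's English description precedes it below -/
import Mathlib

section
/- Let n ≥ 1 and 0 < β ≤ M. Let a, b : ℝⁿ → ℝⁿ be functions such that a is Lipschitz continuous, |a(y)| ≥ β and |a(y)| ≤ M for all y ∈ ℝⁿ, and a(y)·b(y) ≥ 0 for all y ∈ ℝⁿ. Let g : ℝⁿ → ℝ be differentiable with ∇g(y) = a(y) + b(y) for every y ∈ ℝⁿ. Then there exists ŷ ∈ ℝⁿ with g(ŷ) ≥ 0. -/
open scoped RealInnerProductSpace

/-- A bounded Lipschitz vector field has an integral curve on `[0, T]` from any initial point. -/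
theorem LipschitzWith.exists_isIntegralCurveOn_Icc {E : Type*} [NormedAddCommGroup E]
    [NormedSpace ℝ E] [CompleteSpace E] {v : E → E} {K L : NNReal} (hv : LipschitzWith K v)
    (hL : ∀ y, ‖v y‖ ≤ L) (x : E) {T : ℝ} (hT : 0 ≤ T) :
    ∃ γ : ℝ → E, γ 0 = x ∧ IsIntegralCurveOn γ (fun _ ↦ v) (Set.Icc 0 T) := by
  have h : IsPicardLindelof (fun _ ↦ v) (⟨0, le_rfl, hT⟩ : Set.Icc 0 T) x
      (L * T.toNNReal) 0 L K :=
    .of_time_independent (fun y _ ↦ hL y) hv.lipschitzOnWith (by simp [hT])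
  exact h.exists_eq_forall_mem_Icc_hasDerivWithinAt₀

/-- A differentiable function whose derivative along an integral curve of `v` is at least `C`
grows at rate at least `C` along that curve. -/
theorem IsIntegralCurveOn.mul_le_image_sub {E : Type*} [NormedAddCommGroup E]
    [NormedSpace ℝ E] {v : E → E} {γ : ℝ → E} {g : E → ℝ} {C T : ℝ} (hT : 0 ≤ T)
    (hγ : IsIntegralCurveOn γ (fun _ ↦ v) (Set.Icc 0 T)) (hg : Differentiable ℝ g)
    (hC : ∀ y, C ≤ fderiv ℝ g y (v y)) :
    C * T ≤ g (γ T) - g (γ 0) := by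
  have hderiv : ∀ t ∈ interior (Set.Icc 0 T),
      HasDerivAt (g ∘ γ) (fderiv ℝ g (γ t) (v (γ t))) t := fun t ht ↦
    (hg (γ t)).hasFDerivAt.comp_hasDerivAt t
      ((hγ t (interior_subset ht)).hasDerivAt (mem_interior_iff_mem_nhds.mp ht))
  simpa using (convex_Icc 0 T).mul_sub_le_image_sub_of_le_deriv
    (hg.continuous.comp_continuousOn hγ.continuousOn)
    (fun t ht ↦ (hderiv t ht).differentiableAt.differentiableWithinAt)
    (fun t ht ↦ (hderiv t ht).deriv ▸ hC (γ t))
    0 (Set.left_mem_Icc.mpr hT) T (Set.right_mem_Icc.mpr hT) hT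

/-- Finite-dimensional content of Proposition 2.2: if `∇g = a + b` with `a`
Lipschitz, `β ≤ |a| ≤ M` and `a · b ≥ 0`, then `g` is nonnegative somewhere. -/
theorem exists_nonneg_point (n : ℕ) (hn : 1 ≤ n) (β M : ℝ) (hβ : 0 < β) (hβM : β ≤ M)
    (a b : EuclideanSpace ℝ (Fin n) → EuclideanSpace ℝ (Fin n))
    (K : NNReal) (haLip : LipschitzWith K a)
    (ha_lower : ∀ y, β ≤ ‖a y‖) (ha_upper : ∀ y, ‖a y‖ ≤ M)
    (hab : ∀ y, 0 ≤ ⟪a y, b y⟫)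
    (g : EuclideanSpace ℝ (Fin n) → ℝ) (hg : Differentiable ℝ g)
    (hgrad : ∀ y, gradient g y = a y + b y) :
    ∃ yhat : EuclideanSpace ℝ (Fin n), 0 ≤ g yhat := by
  have hgrowth : ∀ y, β ^ 2 ≤ fderiv ℝ g y (a y) := fun y ↦ calc
    β ^ 2 ≤ ‖a y‖ ^ 2 := pow_le_pow_left₀ hβ.le (ha_lower y) 2
    _ ≤ ⟪a y, a y⟫ + ⟪a y, b y⟫ := by
      rw [real_inner_self_eq_norm_sq]
      exact le_add_of_nonneg_right (hab y)
    _ = fderiv ℝ g y (a y) := by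
      rw [← inner_add_right, ← hgrad, real_inner_comm, inner_gradient_left]
  have hT : 0 ≤ |g 0| / β ^ 2 := by positivity
  obtain ⟨γ, hγ0, hγ⟩ := haLip.exists_isIntegralCurveOn_Icc
    (L := ⟨M, hβ.le.trans hβM⟩) ha_upper 0 hT
  have hinc := hγ.mul_le_image_sub hT hg hgrowth
  rw [mul_div_cancel₀ _ (pow_pos hβ 2).ne', hγ0] at hinc
  exact ⟨γ (|g 0| / β ^ 2), by linarith [neg_abs_le (g 0)]⟩
end

section
/- Let n ≥ 1 and 0 < β ≤ M. Let a : ℝⁿ → ℝⁿ be Lipschitz continuous with β ≤ |a(y)| ≤ M for all y ∈ ℝⁿ, and let g : ℝⁿ → ℝ be differentiable with ⟨∇g(y), a(y)⟩ ≥ β² for every y ∈ ℝⁿ. Then for every x₀ ∈ ℝⁿ there exists ŷ ∈ ℝⁿ such that g(ŷ) ≥ 0 and |ŷ − x₀| ≤ (M/β²)·max(−g(x₀), 0). -/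
open scoped RealInnerProductSpace

/-- If `y` maximizes `g - c * ‖· - x₀‖` locally, then the derivative of `g` at `y` in a
direction `v` is at most `c * ‖v‖`. -/
lemma inner_gradient_le_of_isLocalMax_sub_norm {E : Type*} [NormedAddCommGroup E]
    [InnerProductSpace ℝ E] [CompleteSpace E] {g : E → ℝ} {x₀ y v : E} {c : ℝ} (hc : 0 ≤ c)
    (hg : DifferentiableAt ℝ g y) (hy : IsLocalMax (fun z => g z - c * ‖z - x₀‖) y) :
    ⟪gradient g y, v⟫ ≤ c * ‖v‖ := by
  have hline : HasDerivAt (fun t : ℝ => y + t • v) v 0 := by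
    simpa using ((hasDerivAt_id (0 : ℝ)).smul_const v).const_add y
  have hderiv : HasDerivAt (fun t : ℝ => g (y + t • v)) ⟪gradient g y, v⟫ 0 := by
    have hg' : HasFDerivAt g (InnerProductSpace.toDual ℝ E (gradient g y))
        (y + (0 : ℝ) • v) := by
      simpa using hg.hasGradientAt.hasFDerivAt
    simpa [Function.comp_def] using hg'.comp_hasDerivAt 0 hline
  have hslope := hderiv.hasDerivWithinAt (s := Set.Ioi 0)
  rw [hasDerivWithinAt_iff_tendsto_slope' Set.self_notMem_Ioi] at hslope
  have hlim : Filter.Tendsto (fun t : ℝ => y + t • v) (nhds 0) (nhds y) := by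
    simpa using hline.continuousAt.tendsto
  refine le_of_tendsto hslope ?_
  filter_upwards [self_mem_nhdsWithin, nhdsWithin_le_nhds (hlim.eventually hy)] with t ht hmax
  have ht : 0 < t := ht
  have hnorm : ‖y + t • v - x₀‖ ≤ ‖y - x₀‖ + t * ‖v‖ := by
    calc ‖y + t • v - x₀‖ = ‖(y - x₀) + t • v‖ := by congr 1; abel
      _ ≤ ‖y - x₀‖ + ‖t • v‖ := norm_add_le _ _
      _ = ‖y - x₀‖ + t * ‖v‖ := by rw [norm_smul, Real.norm_of_nonneg ht.le]
  have hscaled := mul_le_mul_of_nonneg_left hnorm hc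
  simp only [slope_def_field, sub_zero, zero_smul, add_zero]
  rw [div_le_iff₀ ht]
  linarith

/-- Quantitative finite-dimensional core of Lemma 5.1: from any starting point `x₀`,
there is a point `yhat` with `g yhat ≥ 0` at distance at most `(M/β²)·g⁻(x₀)` from `x₀`. -/
theorem exists_nonneg_point_quantitative (n : ℕ) (hn : 1 ≤ n) (β M : ℝ)
    (hβ : 0 < β) (hβM : β ≤ M)
    (a : EuclideanSpace ℝ (Fin n) → EuclideanSpace ℝ (Fin n))
    (K : NNReal) (haLip : LipschitzWith K a)
    (ha_lower : ∀ y, β ≤ ‖a y‖) (ha_upper : ∀ y, ‖a y‖ ≤ M)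
    (g : EuclideanSpace ℝ (Fin n) → ℝ) (hg : Differentiable ℝ g)
    (hga : ∀ y, β ^ 2 ≤ ⟪gradient g y, a y⟫) :
    ∀ x₀ : EuclideanSpace ℝ (Fin n), ∃ yhat : EuclideanSpace ℝ (Fin n),
      0 ≤ g yhat ∧ ‖yhat - x₀‖ ≤ (M / β ^ 2) * max (-(g x₀)) 0 := by
  intro x₀
  rcases le_or_gt 0 (g x₀) with h₀ | h₀
  · exact ⟨x₀, h₀, by simp [h₀]⟩
  have hM : 0 < M := hβ.trans_le hβM
  rw [max_eq_left (by linarith)]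
  set R := M / β ^ 2 * -(g x₀) with hR
  have hRpos : 0 < R := mul_pos (by positivity) (by linarith)
  have hcompact := isCompact_closedBall x₀ R
  have hx₀ : x₀ ∈ Metric.closedBall x₀ R := Metric.mem_closedBall_self hRpos.le
  obtain ⟨yhat, hyhat, hmax⟩ := hcompact.exists_isMaxOn ⟨x₀, hx₀⟩ hg.continuous.continuousOn
  refine ⟨yhat, ?_, by simpa [dist_eq_norm] using hyhat⟩
  by_contra! hneg
  have hge : g x₀ ≤ g yhat := hmax hx₀
  set c := (g yhat / 2 - g x₀) / R with hc
  have hcR : c * R = g yhat / 2 - g x₀ := div_mul_cancel₀ _ hRpos.ne'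
  have hc_nonneg : 0 ≤ c := div_nonneg (by linarith) hRpos.le
  have hcM : c * M < β ^ 2 := by
    have hRβ : R * β ^ 2 = M * -(g x₀) := by rw [hR]; field_simp
    rw [hc, div_mul_eq_mul_div, div_lt_iff₀ hRpos, mul_comm (β ^ 2), hRβ]
    nlinarith
  obtain ⟨y, hy, hymax⟩ := hcompact.exists_isMaxOn (f := fun z => g z - c * ‖z - x₀‖) ⟨x₀, hx₀⟩
    (hg.continuous.sub (by fun_prop)).continuousOn
  have hy_lt : ‖y - x₀‖ < R := by
    by_contra! hle
    have h₁ : g x₀ - c * ‖x₀ - x₀‖ ≤ g y - c * ‖y - x₀‖ := hymax hx₀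
    have h₂ : g y ≤ g yhat := hmax hy
    have h₃ := mul_le_mul_of_nonneg_left hle hc_nonneg
    simp only [sub_self, norm_zero, mul_zero, sub_zero] at h₁
    linarith
  have hnhds : Metric.closedBall x₀ R ∈ nhds y :=
    Metric.closedBall_mem_nhds_of_mem (by simpa [dist_eq_norm] using hy_lt)
  have hle := inner_gradient_le_of_isLocalMax_sub_norm (v := a y) hc_nonneg (hg y)
    (hymax.isLocalMax hnhds)
  linarith [hga y, mul_le_mul_of_nonneg_left (ha_upper y) hc_nonneg]
end

section
/- Let m, N ≥ 1, β > 0 and M′ > 0. Let A : ℝ^m → ℝ^m be Lipschitz continuous with |A(x)| ≤ M′ for all x ∈ ℝ^m, and let g₁, …, g_N : ℝ^m → ℝ be differentiable functions with ⟨∇g_i(x), A(x)⟩ ≥ β² for every x ∈ ℝ^m and every i ∈ {1, …, N}. Then for every x₀ ∈ ℝ^m there exists x̂ ∈ ℝ^m such that g_i(x̂) ≥ 0 for all i ∈ {1, …, N} and |x̂ − x₀| ≤ (M′/β²)·max_{1 ≤ i ≤ N} max(−g_i(x₀), 0). -/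
open scoped RealInnerProductSpace

open Set Metric in
/-- A bounded, globally Lipschitz vector field has integral curves on every interval `[0, T]`. -/
theorem LipschitzWith.exists_integralCurve_Icc_of_bounded {E : Type*} [NormedAddCommGroup E]
    [NormedSpace ℝ E] [CompleteSpace E] {A : E → E} {K : NNReal} (hA : LipschitzWith K A)
    {L : ℝ} (hL : ∀ x, ‖A x‖ ≤ L) (x₀ : E) {T : ℝ} (hT : 0 ≤ T) :
    ∃ γ : ℝ → E, γ 0 = x₀ ∧ ∀ t ∈ Icc 0 T, HasDerivWithinAt γ (A (γ t)) (Icc 0 T) t := by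
  have hL₀ : 0 ≤ L := (norm_nonneg _).trans (hL x₀)
  lift L to NNReal using hL₀
  lift T to NNReal using hT
  have h : IsPicardLindelof (fun _ ↦ A) (⟨0, left_mem_Icc.2 T.2⟩ : Icc (0 : ℝ) T) x₀
      (L * T) 0 L K :=
    .of_time_independent (fun x _ ↦ hL x) hA.lipschitzOnWith (by simp)
  exact h.exists_eq_forall_mem_Icc_hasDerivWithinAt₀

open Set in
/-- Along an integral curve of `A`, a differentiable function whose gradient has inner product at
least `c` with `A` grows at rate at least `c`. -/
theorem add_mul_le_of_le_inner_gradient {E : Type*} [NormedAddCommGroup E]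
    [InnerProductSpace ℝ E] [CompleteSpace E] {A : E → E} {g : E → ℝ} (hg : Differentiable ℝ g)
    {c : ℝ} (hc : ∀ x, c ≤ ⟪gradient g x, A x⟫) {γ : ℝ → E} {T : ℝ}
    (hγ : ∀ t ∈ Icc 0 T, HasDerivWithinAt γ (A (γ t)) (Icc 0 T) t) {t : ℝ} (ht : t ∈ Icc 0 T) :
    g (γ 0) + c * t ≤ g (γ t) := by
  have hd : ∀ t ∈ Icc 0 T,
      HasDerivWithinAt (fun s ↦ g (γ s)) ⟪gradient g (γ t), A (γ t)⟫ (Icc 0 T) t := fun t ht ↦ by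
    simpa [Function.comp_def] using (hg (γ t)).hasFDerivAt.comp_hasDerivWithinAt t (hγ t ht)
  have hl : ∀ t, HasDerivAt (fun s ↦ g (γ 0) + c * s) c t := fun t ↦ by
    simpa using ((hasDerivAt_id t).const_mul c).const_add (g (γ 0))
  exact image_le_of_deriv_right_le_deriv_boundary (by fun_prop)
    (fun t _ ↦ (hl t).hasDerivWithinAt) (by simp) (fun t ht ↦ (hd t ht).continuousWithinAt)
    (fun t ht ↦ (hd t (Ico_subset_Icc_self ht)).mono_of_mem_nhdsWithin
      (Icc_mem_nhdsGE_of_mem ht)) (fun t _ ↦ hc (γ t)) ht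

/-- N-particle version of the flow argument in Lemma 5.1: following the flow of `A`
from `x₀` one finds `xhat` satisfying all constraints `gᵢ ≥ 0`, within distance
`(M'/β²)·maxᵢ gᵢ⁻(x₀)` of `x₀`. -/
theorem particle_system_flow (m N : ℕ) (hm : 1 ≤ m) (hN : 1 ≤ N) (β M' : ℝ)
    (hβ : 0 < β) (hM' : 0 < M')
    (A : EuclideanSpace ℝ (Fin m) → EuclideanSpace ℝ (Fin m))
    (K : NNReal) (hALip : LipschitzWith K A) (hAb : ∀ x, ‖A x‖ ≤ M')
    (g : Fin N → EuclideanSpace ℝ (Fin m) → ℝ)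
    (hg : ∀ i, Differentiable ℝ (g i))
    (hga : ∀ i x, β ^ 2 ≤ ⟪gradient (g i) x, A x⟫) :
    ∀ x₀ : EuclideanSpace ℝ (Fin m), ∃ xhat : EuclideanSpace ℝ (Fin m),
      (∀ i, 0 ≤ g i xhat) ∧
      ‖xhat - x₀‖ ≤ (M' / β ^ 2) *
        Finset.univ.sup' (Finset.univ_nonempty_iff.mpr (Fin.pos_iff_nonempty.mp hN))
          (fun i => max (-(g i x₀)) 0) := by
  intro x₀
  set S := Finset.univ.sup' (Finset.univ_nonempty_iff.mpr (Fin.pos_iff_nonempty.mp hN))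
    (fun i => max (-(g i x₀)) 0)
  have hS : ∀ i, max (-(g i x₀)) 0 ≤ S := fun i ↦
    Finset.le_sup' (fun i => max (-(g i x₀)) 0) (Finset.mem_univ i)
  have hT : 0 ≤ S / β ^ 2 := div_nonneg ((le_max_right _ _).trans (hS ⟨0, hN⟩)) (sq_nonneg β)
  obtain ⟨γ, rfl, hγ⟩ := hALip.exists_integralCurve_Icc_of_bounded hAb x₀ hT
  refine ⟨γ (S / β ^ 2), fun i ↦ ?_, ?_⟩
  · have h := add_mul_le_of_le_inner_gradient (hg i) (hga i) hγ (Set.right_mem_Icc.2 hT)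
    rw [mul_div_cancel₀ S (by positivity : β ^ 2 ≠ 0)] at h
    linarith [(le_max_left _ _).trans (hS i)]
  · calc ‖γ (S / β ^ 2) - γ 0‖ ≤ M' * (S / β ^ 2 - 0) :=
        norm_image_sub_le_of_norm_deriv_le_segment' hγ (fun t _ ↦ hAb (γ t)) _
          (Set.right_mem_Icc.2 hT)
      _ = M' / β ^ 2 * S := by ring
end
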